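/- For every continuously differentiable, compactly supported function w : ℝ² → ℝ², one has ∫_{ℝ²} |w(x)|⁴ dx ≤ (1/2) (∫_{ℝ²} |w(x)|² dx)(∫_{ℝ²} |∇w(x)|² dx), where |∇w|² = ∑_{i,j} (∂w_i/∂x_j)². -/

import Mathlib

open MeasureTheory Real Set

noncomputable section

/-- The plane `ℝ²` with its Euclidean structure. -/
abbrev E2 : Type := EuclideanSpace ℝ (Fin 2)

/-- Spatial partial derivative `∂f/∂xᵢ`. -/
def pd (f : E2 → ℝ) (i : Fin 2) (x : E2) : ℝ :=
  fderiv ℝ f x (EuclideanSpace.single i 1)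

/-- Spatial Laplacian `Δf = ∑ᵢ ∂²f/∂xᵢ²`. -/
def lap (f : E2 → ℝ) (x : E2) : ℝ :=
  ∑ i, pd (pd f i) i x

/-- `|∇f|² = ∑ᵢ (∂f/∂xᵢ)²` for a scalar field. -/
def gradSq (f : E2 → ℝ) (x : E2) : ℝ :=
  ∑ i, (pd f i x) ^ 2

/-- `|∇w|² = ∑ᵢⱼ (∂wᵢ/∂xⱼ)²` for a vector field. -/
def gradSqV (w : E2 → E2) (x : E2) : ℝ :=
  ∑ i, ∑ j, (pd (fun y => w y i) j x) ^ 2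

/-- Pointwise bound of `‖u‖²` by the integral of `‖u‖ ‖u'‖` for a compactly supported curve. -/
theorem norm_sq_le_integral_norm_mul_norm_deriv {F : Type*} [NormedAddCommGroup F]
    [InnerProductSpace ℝ F] {u : ℝ → F} (hu : ContDiff ℝ 1 u) (hc : HasCompactSupport u) (t : ℝ) :
    ‖u t‖ ^ 2 ≤ ∫ s, ‖u s‖ * ‖deriv u s‖ := by
  have hg : ContDiff ℝ 1 fun s => ‖u s‖ ^ 2 := hu.norm_sq ℝ
  have hgc : HasCompactSupport fun s => ‖u s‖ ^ 2 :=
    hc.comp_left (g := fun v : F => ‖v‖ ^ 2) (by simp)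
  have hderiv (s : ℝ) : |deriv (fun s => ‖u s‖ ^ 2) s| ≤ 2 * (‖u s‖ * ‖deriv u s‖) := by
    rw [((hu.differentiable one_ne_zero s).hasDerivAt.norm_sq).deriv, abs_mul, abs_two]
    gcongr
    exact abs_real_inner_le_norm _ _
  have hcont : Continuous (deriv fun s => ‖u s‖ ^ 2) := hg.continuous_deriv le_rfl
  have hgi : Integrable (deriv fun s => ‖u s‖ ^ 2) :=
    hcont.integrable_of_hasCompactSupport hgc.deriv
  have hui : Integrable fun s => ‖u s‖ * ‖deriv u s‖ :=
    (hu.continuous.norm.mul (hu.continuous_deriv le_rfl).norm).integrable_of_hasCompactSupport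
      hc.norm.mul_right
  have h1 := hgc.integral_Iic_deriv_eq hg t
  have h2 := hgc.integral_Ioi_deriv_eq hg t
  have h3 : ‖u t‖ ^ 2 ≤ ∫ s in Iic t, |deriv (fun s => ‖u s‖ ^ 2) s| := by
    rw [← h1]; exact (le_abs_self _).trans abs_integral_le_integral_abs
  have h4 : ‖u t‖ ^ 2 ≤ ∫ s in Ioi t, |deriv (fun s => ‖u s‖ ^ 2) s| := by
    rw [← neg_neg (‖u t‖ ^ 2), ← h2]
    exact (neg_le_abs _).trans abs_integral_le_integral_abs
  have h5 := intervalIntegral.integral_Iic_add_Ioi (b := t) hgi.abs.integrableOn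
    hgi.abs.integrableOn
  have h6 := integral_mono hgi.abs (hui.const_mul 2) hderiv
  rw [integral_const_mul] at h6
  linarith

/-- A function on the plane dominated by a function of each variable, each being a partial
integral, has square integral at most the product of the full integrals. -/
theorem integral_sq_le_integral_mul_integral_of_le_partial_integral {g p q : ℝ × ℝ → ℝ}
    (hg0 : 0 ≤ g) (hp : Integrable p) (hq : Integrable q)
    (hgp : ∀ a b, g (a, b) ≤ ∫ s, p (s, b)) (hgq : ∀ a b, g (a, b) ≤ ∫ t, q (a, t)) :
    ∫ z, g z ^ 2 ≤ (∫ z, p z) * ∫ z, q z := by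
  have hp' : Integrable fun b => ∫ s, p (s, b) := hp.integral_prod_right
  have hq' : Integrable fun a => ∫ t, q (a, t) := hq.integral_prod_left
  have hprod : (∫ z : ℝ × ℝ, (∫ t, q (z.1, t)) * ∫ s, p (s, z.2)) =
      (∫ z, p z) * ∫ z, q z := by
    have := integral_prod_mul (μ := volume) (ν := volume) (fun a : ℝ => ∫ t, q (a, t))
      (fun b : ℝ => ∫ s, p (s, b))
    rw [Measure.volume_eq_prod, this, mul_comm, integral_prod_symm p hp, integral_prod q hq]
  rw [← hprod]
  refine integral_mono_of_nonneg (.of_forall fun z => sq_nonneg _) (hq'.mul_prod hp')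
    (.of_forall fun z => ?_)
  simp only [sq]
  exact mul_le_mul (hgq _ _) (hgp _ _) (hg0 z) ((hg0 z).trans (hgq _ _))

/-- The Cauchy–Schwarz inequality for real square-integrable functions. -/
theorem sq_integral_mul_le {α : Type*} [MeasurableSpace α] {μ : Measure α} {f g : α → ℝ}
    (hf : Integrable (fun x => f x ^ 2) μ) (hg : Integrable (fun x => g x ^ 2) μ)
    (hfg : Integrable (fun x => f x * g x) μ) :
    (∫ x, f x * g x ∂μ) ^ 2 ≤ (∫ x, f x ^ 2 ∂μ) * ∫ x, g x ^ 2 ∂μ := by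
  have h (t : ℝ) : 0 ≤ (∫ x, f x ^ 2 ∂μ) * (t * t) + (2 * ∫ x, f x * g x ∂μ) * t
      + ∫ x, g x ^ 2 ∂μ := by
    have h0 : 0 ≤ ∫ x, (f x ^ 2 * (t * t) + f x * g x * (2 * t) + g x ^ 2) ∂μ :=
      integral_nonneg fun x => by
        have := sq_nonneg (f x * t + g x)
        simp only [Pi.zero_apply]
        linarith
    rw [integral_add (by exact (hf.mul_const _).add (hfg.mul_const _)) hg,
      integral_add (hf.mul_const _) (hfg.mul_const _), integral_mul_const,
      integral_mul_const] at h0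
    linarith
  have := discrim_le_zero h
  rw [discrim] at this
  linarith

/-- Cartesian coordinates on the plane preserve volume. -/
theorem measurePreserving_toLp_vec :
    MeasurePreserving (fun z : ℝ × ℝ => (!₂[z.1, z.2] : E2)) :=
  (EuclideanSpace.volume_preserving_symm_measurableEquiv_toLp (Fin 2)).symm.comp
    (volume_preserving_finTwoArrow ℝ).symm

theorem measurableEmbedding_toLp_vec :
    MeasurableEmbedding (fun z : ℝ × ℝ => (!₂[z.1, z.2] : E2)) :=
  (MeasurableEquiv.finTwoArrow.symm.trans (MeasurableEquiv.toLp 2 (Fin 2 → ℝ))).measurableEmbedding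

/-- A compactly supported field is bounded along a line by the integral of the field times its
derivative along that line. -/
theorem norm_sq_le_integral_line {E F : Type*} [NormedAddCommGroup E] [NormedSpace ℝ E]
    [NormedAddCommGroup F] [InnerProductSpace ℝ F] {w : E → F} (hw : ContDiff ℝ 1 w)
    (hc : HasCompactSupport w) (x : E) {v : E} (hv : ‖v‖ = 1) (t : ℝ) :
    ‖w (x + t • v)‖ ^ 2 ≤ ∫ s : ℝ, ‖w (x + s • v)‖ * ‖fderiv ℝ w (x + s • v) v‖ := by
  have hline : Isometry fun s : ℝ => x + s • v := .of_dist_eq fun s t => by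
    rw [dist_add_left, dist_eq_norm, ← sub_smul, norm_smul, hv, mul_one, dist_eq_norm]
  have hderiv (s : ℝ) : deriv (fun s : ℝ => w (x + s • v)) s = fderiv ℝ w (x + s • v) v := by
    have hl : HasDerivAt (fun s : ℝ => x + s • v) v s := by
      simpa using ((hasDerivAt_id s).smul_const v).const_add x
    exact ((hw.differentiable one_ne_zero _).hasFDerivAt.comp_hasDerivAt s hl).deriv
  have hu : ContDiff ℝ 1 fun s : ℝ => w (x + s • v) := hw.comp (by fun_prop)
  simpa only [hderiv] using norm_sq_le_integral_norm_mul_norm_deriv hu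
    (hc.comp_isClosedEmbedding hline.isClosedEmbedding) t

/-- `|∇w|²` is the sum of the squared norms of the partial derivatives of `w`. -/
theorem gradSqV_eq_sum_norm_fderiv_sq {w : E2 → E2} {x : E2} (hw : DifferentiableAt ℝ w x) :
    gradSqV w x = ‖fderiv ℝ w x (EuclideanSpace.single 0 1)‖ ^ 2
      + ‖fderiv ℝ w x (EuclideanSpace.single 1 1)‖ ^ 2 := by
  have h (i j : Fin 2) : pd (fun y => w y i) j x =
      fderiv ℝ w x (EuclideanSpace.single j 1) i := by
    have := ((EuclideanSpace.proj (𝕜 := ℝ) i).hasFDerivAt.comp x hw.hasFDerivAt).fderiv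
    exact congrArg (fun L : E2 →L[ℝ] ℝ => L (EuclideanSpace.single j 1)) this
  simp only [gradSqV, h, EuclideanSpace.norm_sq_eq, Fin.sum_univ_two, Real.norm_eq_abs, sq_abs]
  ring

theorem integrable_sq_of_hasCompactSupport {f : E2 → ℝ} (hf : Continuous f)
    (hc : HasCompactSupport f) : Integrable fun x => f x ^ 2 := by
  simp only [sq]
  exact (hf.mul hf).integrable_of_hasCompactSupport hc.mul_right

/-- **Payne's two-dimensional Sobolev (Ladyzhenskaya) inequality** with constant `1/2`:
for every continuously differentiable, compactly supported `w : ℝ² → ℝ²`,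
`∫ |w|⁴ ≤ (1/2) (∫ |w|²)(∫ |∇w|²)`. -/
theorem sobolev_inequality_payne
    (w : E2 → E2) (hw : ContDiff ℝ 1 w) (hsupp : HasCompactSupport w) :
    (∫ x : E2, ‖w x‖ ^ 4) ≤
      (1 / 2) * ((∫ x : E2, ‖w x‖ ^ 2) * (∫ x : E2, gradSqV w x)) := by
  set D : Fin 2 → E2 → ℝ := fun j x => ‖fderiv ℝ w x (EuclideanSpace.single j 1)‖
  have hDcont (j : Fin 2) : Continuous (D j) :=
    ((hw.continuous_fderiv one_ne_zero).clm_apply continuous_const).norm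
  have hDsupp (j : Fin 2) : HasCompactSupport (D j) :=
    (hsupp.fderiv (𝕜 := ℝ)).comp_left
      (g := fun L : E2 →L[ℝ] E2 => ‖L (EuclideanSpace.single j 1)‖) (by simp)
  have hwsq : Integrable fun x => ‖w x‖ ^ 2 :=
    integrable_sq_of_hasCompactSupport hw.continuous.norm hsupp.norm
  have hDsq (j : Fin 2) : Integrable fun x => D j x ^ 2 :=
    integrable_sq_of_hasCompactSupport (hDcont j) (hDsupp j)
  have hwD (j : Fin 2) : Integrable fun x => ‖w x‖ * D j x :=
    (hw.continuous.norm.mul (hDcont j)).integrable_of_hasCompactSupport hsupp.norm.mul_right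
  have hslice0 (s b : ℝ) : (!₂[s, b] : E2) = !₂[0, b] + s • EuclideanSpace.single 0 1 := by
    ext i; fin_cases i <;> simp
  have hslice1 (a t : ℝ) : (!₂[a, t] : E2) = !₂[a, 0] + t • EuclideanSpace.single 1 1 := by
    ext i; fin_cases i <;> simp
  have hintegral (f : E2 → ℝ) : ∫ z : ℝ × ℝ, f !₂[z.1, z.2] = ∫ x, f x :=
    measurePreserving_toLp_vec.integral_comp measurableEmbedding_toLp_vec f
  have hintegrable {f : E2 → ℝ} (hf : Integrable f) :
      Integrable fun z : ℝ × ℝ => f !₂[z.1, z.2] :=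
    measurePreserving_toLp_vec.integrable_comp_of_integrable hf
  have hmain : ∫ x, ‖w x‖ ^ 4 ≤ (∫ x, ‖w x‖ * D 0 x) * ∫ x, ‖w x‖ * D 1 x := by
    have := integral_sq_le_integral_mul_integral_of_le_partial_integral
      (g := fun z => ‖w !₂[z.1, z.2]‖ ^ 2) (fun z => sq_nonneg _)
      (hintegrable (hwD 0)) (hintegrable (hwD 1))
      (fun a b => by
        simpa only [← hslice0] using norm_sq_le_integral_line hw hsupp !₂[0, b]
          (v := EuclideanSpace.single 0 1) (by simp) a)
      (fun a b => by
        simpa only [← hslice1] using norm_sq_le_integral_line hw hsupp !₂[a, 0]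
          (v := EuclideanSpace.single 1 1) (by simp) b)
    rw [hintegral fun x => ‖w x‖ * D 0 x, hintegral fun x => ‖w x‖ * D 1 x,
      hintegral fun x => (‖w x‖ ^ 2) ^ 2] at this
    simpa only [← pow_mul] using this
  have hgrad : ∫ x, gradSqV w x = (∫ x, D 0 x ^ 2) + ∫ x, D 1 x ^ 2 := by
    rw [← integral_add (hDsq 0) (hDsq 1)]
    exact integral_congr_ae (.of_forall fun x =>
      gradSqV_eq_sum_norm_fderiv_sq (hw.differentiable one_ne_zero x))
  have h0 := sq_integral_mul_le hwsq (hDsq 0) (hwD 0)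
  have h1 := sq_integral_mul_le hwsq (hDsq 1) (hwD 1)
  have h2 := two_mul_le_add_sq (∫ x, ‖w x‖ * D 0 x) (∫ x, ‖w x‖ * D 1 x)
  rw [hgrad, mul_add]
  linarith
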